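/- arXiv:1901.03744 — 4 statements merged into one kernel-verified Lean document; each statement's English description precedes it below -/
import Mathlib

section
/- Fix a graph G = (V, E), a permutation π over E, and a parameter p ∈ (0, 1]. Let G_p = (V, E_p) be the random subgraph of G in which each edge of E appears independently with probability p, and let M = GreedyMM(G_p, π). Then for any vertex v and any parameter β ∈ (0, 1/2), with probability at least 1 − β, the residual degree of v satisfies deg^res_M(v) ≤ ln(1/β)/p. -/
open Finset
open scoped Classical

section Defs

private lemma sym2_exists_mem {V : Type*} (e : Sym2 V) : ∃ a, a ∈ e :=
  ⟨(Quot.out e).1, Sym2.out_fst_mem e⟩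

variable {V : Type*} [Fintype V] [DecidableEq V]

/-- The greedy maximal matching of the graph with edge set `E`, processing edges in
increasing order of the priority function `ρ`: repeatedly pick the minimum-priority
remaining edge, add it to the matching, and discard all edges meeting it. -/
noncomputable def greedyMM {β : Type*} [LinearOrder β] (ρ : Sym2 V → β) (E : Finset (Sym2 V)) :
    Finset (Sym2 V) :=
  if h : E.Nonempty then
    insert (Classical.choose (E.exists_min_image ρ h))
      (greedyMM ρ (E.filter fun f =>
        ¬ ∃ v, v ∈ Classical.choose (E.exists_min_image ρ h) ∧ v ∈ f))
  else ∅
termination_by E.card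
decreasing_by
  have he : Classical.choose (E.exists_min_image ρ h) ∈ E :=
    (Classical.choose_spec (E.exists_min_image ρ h)).1
  apply Finset.card_lt_card
  refine (Finset.ssubset_iff_of_subset (Finset.filter_subset _ _)).2 ⟨_, he, ?_⟩
  intro hmem
  obtain ⟨a, ha⟩ := sym2_exists_mem (Classical.choose (E.exists_min_image ρ h))
  exact (Finset.mem_filter.1 hmem).2 ⟨a, ha, ha⟩

/-- The set of vertices matched by a set `M` of edges. -/
noncomputable def matchedV (M : Finset (Sym2 V)) : Finset V :=
  Finset.univ.filter fun v => ∃ e ∈ M, v ∈ e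

/-- Residual degree of `v` with respect to the matching `M` in the graph with edge set `E`:
`0` if `v` is matched, and otherwise the degree of `v` in the induced subgraph on
unmatched vertices. -/
noncomputable def resDeg (E M : Finset (Sym2 V)) (v : V) : ℕ :=
  if v ∈ matchedV M then 0
  else (E.filter fun e => v ∈ e ∧ ∀ w ∈ e, w ∉ matchedV M).card

/-- The number of vertices whose match-status differs between `M` and `M'`. -/
noncomputable def statusDiff (M M' : Finset (Sym2 V)) : ℕ :=
  (Finset.univ.filter fun v => ¬ (v ∈ matchedV M ↔ v ∈ matchedV M')).card

end Defs

section SampledSubsets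

variable {α : Type*}

/-- The expectation of `f S` when `S ⊆ E` contains each element of `E` independently with
probability `p`. -/
noncomputable def sampledExpect (p : ℝ) (E : Finset α) (f : Finset α → ℝ) : ℝ :=
  ∑ S ∈ E.powerset, p ^ S.card * (1 - p) ^ (E.card - S.card) * f S

lemma sampledExpect_insert [DecidableEq α] (p : ℝ) {e : α} {E : Finset α} (he : e ∉ E) (f : Finset α → ℝ) :
    sampledExpect p (insert e E) f =
      p * sampledExpect p E (fun S => f (insert e S)) + (1 - p) * sampledExpect p E f := by
  unfold sampledExpect
  rw [Finset.sum_powerset_insert he, add_comm, Finset.mul_sum, Finset.mul_sum]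
  congr 1
  · refine Finset.sum_congr rfl fun S hS => ?_
    have heS : e ∉ S := fun h => he (Finset.mem_powerset.1 hS h)
    rw [Finset.card_insert_of_notMem heS, Finset.card_insert_of_notMem he,
      Nat.add_sub_add_right]
    ring
  · refine Finset.sum_congr rfl fun S hS => ?_
    have hcard := Finset.card_le_card (Finset.mem_powerset.1 hS)
    rw [Finset.card_insert_of_notMem he, Nat.sub_add_comm hcard]
    ring

lemma sampledExpect_mono {p : ℝ} (hp0 : 0 ≤ p) (hp1 : p ≤ 1) {E : Finset α}
    {f g : Finset α → ℝ} (h : ∀ S ⊆ E, f S ≤ g S) :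
    sampledExpect p E f ≤ sampledExpect p E g := by
  refine Finset.sum_le_sum fun S hS => mul_le_mul_of_nonneg_left (h S (Finset.mem_powerset.1 hS)) ?_
  have : 0 ≤ 1 - p := by linarith
  positivity

lemma sampledExpect_congr {p : ℝ} {E : Finset α} {f g : Finset α → ℝ}
    (h : ∀ S ⊆ E, f S = g S) : sampledExpect p E f = sampledExpect p E g :=
  Finset.sum_congr rfl fun S hS => by rw [h S (Finset.mem_powerset.1 hS)]

lemma sampledExpect_one (p : ℝ) (E : Finset α) : sampledExpect p E (fun _ => 1) = 1 := by
  induction E using Finset.induction_on with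
  | empty => simp [sampledExpect]
  | insert e E he ih => rw [sampledExpect_insert p he, ih]; ring

lemma sampledExpect_filter (p : ℝ) (E : Finset α) (q : α → Prop) [DecidablePred q]
    (f : Finset α → ℝ) :
    sampledExpect p E (fun S => f (S.filter q)) = sampledExpect p (E.filter q) f := by
  induction E using Finset.induction_on generalizing f with
  | empty => simp [sampledExpect]
  | insert e E he ih =>
    rw [sampledExpect_insert p he, ih f]
    by_cases hq : q e
    · have he' : e ∉ E.filter q := fun h => he (Finset.mem_filter.1 h).1
      simp only [Finset.filter_insert, if_pos hq]
      rw [sampledExpect_insert p he', ih fun S => f (insert e S)]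
    · simp only [Finset.filter_insert, if_neg hq]
      rw [ih f]
      ring

end SampledSubsets

section GreedyMatching

variable {V : Type*} [Fintype V] [DecidableEq V]

lemma mem_matchedV {M : Finset (Sym2 V)} {w : V} : w ∈ matchedV M ↔ ∃ e ∈ M, w ∈ e := by
  simp [matchedV]

lemma mem_matchedV_insert {M : Finset (Sym2 V)} {e : Sym2 V} {w : V} :
    w ∈ matchedV (insert e M) ↔ w ∈ e ∨ w ∈ matchedV M := by
  simp [mem_matchedV]

lemma greedyMM_insert_min {β : Type*} [LinearOrder β] (π : Sym2 V → β) {e : Sym2 V}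
    {S : Finset (Sym2 V)} (hmin : ∀ f ∈ S, π e < π f) :
    greedyMM π (insert e S) =
      insert e (greedyMM π (S.filter fun f => ¬ ∃ w, w ∈ e ∧ w ∈ f)) := by
  have hne : (insert e S).Nonempty := Finset.insert_nonempty e S
  have hchoose : Classical.choose ((insert e S).exists_min_image π hne) = e := by
    obtain ⟨hmem, hle⟩ := Classical.choose_spec ((insert e S).exists_min_image π hne)
    rcases Finset.mem_insert.1 hmem with h | h
    · exact h
    · exact absurd (hle e (Finset.mem_insert_self e S)) (not_le.2 (hmin _ h))
  rw [greedyMM, dif_pos hne, hchoose, Finset.filter_insert, if_neg]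
  obtain ⟨a, ha⟩ : ∃ a, a ∈ e := ⟨_, Sym2.out_fst_mem e⟩
  exact fun h => h ⟨a, ha, ha⟩

lemma resDeg_insert_matching_of_mem (E M : Finset (Sym2 V)) {e : Sym2 V} {v : V} (hv : v ∈ e) :
    resDeg E (insert e M) v = 0 :=
  if_pos (mem_matchedV_insert.2 (Or.inl hv))

lemma resDeg_insert_insert_of_notMem (E M : Finset (Sym2 V)) {e : Sym2 V} {v : V} (hv : v ∉ e) :
    resDeg (insert e E) (insert e M) v =
      resDeg (E.filter fun f => ¬ ∃ w, w ∈ e ∧ w ∈ f) M v := by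
  unfold resDeg
  simp only [mem_matchedV_insert, hv, false_or]
  congr 2
  ext f
  simp only [Finset.mem_filter, Finset.mem_insert]
  constructor
  · rintro ⟨hf | hf, hvf, h⟩
    · exact absurd (hf ▸ hvf) hv
    · exact ⟨⟨hf, fun ⟨w, hwe, hwf⟩ => h w hwf (Or.inl hwe)⟩, hvf,
        fun w hw hM => h w hw (Or.inr hM)⟩
  · rintro ⟨⟨hf, hef⟩, hvf, h⟩
    exact ⟨Or.inr hf, hvf, fun w hw hor => hor.elim (fun hwe => hef ⟨w, hwe, hw⟩) (h w hw)⟩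

lemma resDeg_insert_edge_of_notMem (E M : Finset (Sym2 V)) {e : Sym2 V} {v : V} (hv : v ∉ e) :
    resDeg (insert e E) M v = resDeg E M v := by
  have hfilter : ¬ (v ∈ e ∧ ∀ w ∈ e, w ∉ matchedV M) := fun h => hv h.1
  simp only [resDeg, Finset.filter_insert, if_neg hfilter]

lemma resDeg_insert_edge_le (E M : Finset (Sym2 V)) (e : Sym2 V) (v : V) :
    resDeg (insert e E) M v ≤ resDeg E M v + 1 := by
  unfold resDeg
  split_ifs
  · exact Nat.zero_le _
  · rw [Finset.filter_insert]
    split_ifs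
    · exact Finset.card_insert_le _ _
    · exact Nat.le_succ _

/-- The greedy matching of a random edge sample leaves `v` with residual degree at least `k`
with probability at most `(1 - p) ^ k`. -/
lemma sampledExpect_le_resDeg_greedyMM {β : Type*} [LinearOrder β] (π : Sym2 V → β)
    {p : ℝ} (hp0 : 0 ≤ p) (hp1 : p ≤ 1) (v : V) (E : Finset (Sym2 V)) (hπ : Set.InjOn π ↑E)
    (k : ℕ) :
    sampledExpect p E (fun S => if k ≤ resDeg E (greedyMM π S) v then 1 else 0) ≤
      (1 - p) ^ k := by
  induction E using Finset.strongInduction generalizing k with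
  | H E ih =>
  have hq : 0 ≤ 1 - p := by linarith
  cases k with
  | zero => simp [sampledExpect_one]
  | succ k =>
  rcases E.eq_empty_or_nonempty with rfl | hne
  · simp only [resDeg, Finset.filter_empty, Finset.card_empty, ite_self]
    simpa [sampledExpect] using pow_nonneg hq (k + 1)
  obtain ⟨e, heE, hle⟩ := E.exists_min_image π hne
  obtain ⟨F, heF, rfl⟩ : ∃ F, e ∉ F ∧ insert e F = E :=
    ⟨E.erase e, Finset.notMem_erase e E, Finset.insert_erase heE⟩
  have hmin : ∀ f ∈ F, π e < π f := fun f hf => by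
    have hfE := Finset.mem_insert_of_mem (b := e) hf
    refine lt_of_le_of_ne (hle f hfE) fun h => heF ?_
    rw [hπ (Finset.mem_coe.2 heE) (Finset.mem_coe.2 hfE) h]
    exact hf
  have ih' : ∀ F' ⊆ F, ∀ k,
      sampledExpect p F' (fun S => if k ≤ resDeg F' (greedyMM π S) v then 1 else 0) ≤
        (1 - p) ^ k := fun F' hF' k =>
    ih F' (hF'.trans_ssubset (Finset.ssubset_insert heF))
      (hπ.mono (Finset.coe_subset.2 (hF'.trans (Finset.subset_insert e F)))) k
  have hgreedy : ∀ S ⊆ F, greedyMM π (insert e S) =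
      insert e (greedyMM π (S.filter fun f => ¬ ∃ w, w ∈ e ∧ w ∈ f)) := fun S hS =>
    greedyMM_insert_min π fun f hf => hmin f (hS hf)
  rw [sampledExpect_insert p heF]
  by_cases hv : v ∈ e
  · have hsampled : sampledExpect p F (fun S =>
        if k + 1 ≤ resDeg (insert e F) (greedyMM π (insert e S)) v then 1 else 0) = 0 := by
      rw [sampledExpect_congr (g := fun _ => 0) fun S hS => by
        rw [hgreedy S hS, resDeg_insert_matching_of_mem _ _ hv, if_neg (by omega)]]
      simp [sampledExpect]
    have hunsampled : sampledExpect p F (fun S =>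
        if k + 1 ≤ resDeg (insert e F) (greedyMM π S) v then 1 else 0) ≤ (1 - p) ^ k := by
      refine (sampledExpect_mono hp0 hp1 fun S _ => ?_).trans (ih' F subset_rfl k)
      have := resDeg_insert_edge_le F (greedyMM π S) e v
      split_ifs <;> first | omega | norm_num
    rw [hsampled, mul_zero, zero_add, pow_succ']
    exact mul_le_mul_of_nonneg_left hunsampled hq
  · have hsampled : sampledExpect p F (fun S =>
        if k + 1 ≤ resDeg (insert e F) (greedyMM π (insert e S)) v then 1 else 0) ≤
          (1 - p) ^ (k + 1) := by
      refine le_trans (le_of_eq ?_)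
        (ih' (F.filter fun f => ¬ ∃ w, w ∈ e ∧ w ∈ f) (Finset.filter_subset _ F) (k + 1))
      rw [← sampledExpect_filter]
      exact sampledExpect_congr fun S hS => by
        rw [hgreedy S hS, resDeg_insert_insert_of_notMem _ _ hv]
    have hunsampled : sampledExpect p F (fun S =>
        if k + 1 ≤ resDeg (insert e F) (greedyMM π S) v then 1 else 0) ≤ (1 - p) ^ (k + 1) := by
      simpa only [resDeg_insert_edge_of_notMem F _ hv] using ih' F subset_rfl (k + 1)
    calc _ ≤ p * (1 - p) ^ (k + 1) + (1 - p) * (1 - p) ^ (k + 1) :=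
          add_le_add (mul_le_mul_of_nonneg_left hsampled hp0)
            (mul_le_mul_of_nonneg_left hunsampled hq)
      _ = (1 - p) ^ (k + 1) := by ring

end GreedyMatching

/-- **Greedy matching on an edge-sampled subgraph reduces degrees** (Lemma A.1).
Fix a graph `G = (V, E)`, an ordering `π` of its edges, and `p ∈ (0,1]`.  Let `G_p` be the
random subgraph of `G` in which every edge of `E` appears independently with probability
`p` (modeled below by summing over all subsets `S ⊆ E` with their Bernoulli product
weights `p^{|S|}(1-p)^{|E|-|S|}`), and let `M = GreedyMM(G_p, π)`.  Then for every vertex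
`v` and every `β ∈ (0, 1/2)`, with probability at least `1 - β` the residual degree of `v`
(in `G`) satisfies `deg^res_M(v) ≤ ln(1/β)/p`. -/
theorem greedy_on_sampled_subgraph_reduces_degree
    {V : Type*} [Fintype V] [DecidableEq V]
    (E : Finset (Sym2 V)) (hE : ∀ e ∈ E, ¬ e.IsDiag)
    (π : Sym2 V → ℕ) (hπ : Set.InjOn π ↑E)
    (p : ℝ) (hp0 : 0 < p) (hp1 : p ≤ 1)
    (v : V) (β : ℝ) (hβ0 : 0 < β) (hβ1 : β < 1 / 2) :
    1 - β ≤ ∑ S ∈ E.powerset,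
      (if (resDeg E (greedyMM π S) v : ℝ) ≤ Real.log (1 / β) / p then
        p ^ S.card * (1 - p) ^ (E.card - S.card) else 0) := by
  set t := Real.log (1 / β) / p with ht
  have htail := sampledExpect_le_resDeg_greedyMM π hp0.le hp1 v E hπ (⌊t⌋₊ + 1)
  have hbound : (1 - p) ^ (⌊t⌋₊ + 1) ≤ β := calc
    (1 - p) ^ (⌊t⌋₊ + 1) ≤ Real.exp (-p) ^ (⌊t⌋₊ + 1) :=
      pow_le_pow_left₀ (by linarith) (Real.one_sub_le_exp_neg p) _
    _ = Real.exp (-(p * (⌊t⌋₊ + 1 : ℝ))) := by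
      rw [← Real.exp_nat_mul]; push_cast; ring_nf
    _ ≤ Real.exp (-(p * t)) := by
      have := (Nat.lt_floor_add_one t).le
      gcongr
    _ = β := by
      rw [ht, mul_div_cancel₀ _ hp0.ne', one_div, Real.log_inv, neg_neg, Real.exp_log hβ0]
  have hsplit : (∑ S ∈ E.powerset, (if (resDeg E (greedyMM π S) v : ℝ) ≤ t then
        p ^ S.card * (1 - p) ^ (E.card - S.card) else 0)) +
      sampledExpect p E (fun S => if ⌊t⌋₊ + 1 ≤ resDeg E (greedyMM π S) v then 1 else 0) = 1 := by
    refine Eq.trans ?_ (sampledExpect_one p E)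
    unfold sampledExpect
    rw [← Finset.sum_add_distrib]
    have ht0 : 0 ≤ t :=
      div_nonneg (Real.log_nonneg (by rw [le_div_iff₀ hβ0]; linarith)) hp0.le
    refine Finset.sum_congr rfl fun S _ => ?_
    have hfloor := Nat.le_floor_iff (n := resDeg E (greedyMM π S) v) ht0
    by_cases hle : (resDeg E (greedyMM π S) v : ℝ) ≤ t
    · have := hfloor.2 hle
      simp only [if_pos hle]
      rw [if_neg (by omega)]
      ring
    · have := mt hfloor.1 hle
      simp only [if_neg hle]
      rw [if_pos (by omega)]
      ring
  linarith
end

section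
/- Fix a graph G = (V, E) and an injective priority assignment ρ : E → [0,1]. If ρ' is an injective priority assignment obtained from ρ by changing the value of a single edge, then there are at most 2 vertices whose match-status differs between GreedyMM(G, ρ) and GreedyMM(G, ρ'). -/
open Finset
open scoped Classical

/-- `M` is a matching in `E` such that every edge of `E` outside `M` meets an edge of `M` of
strictly smaller priority. -/
structure IsGreedyMatching {V β : Type*} [LinearOrder β] (ρ : Sym2 V → β)
    (E M : Finset (Sym2 V)) : Prop where
  subset : M ⊆ E
  disjoint : ∀ e ∈ M, ∀ f ∈ M, e ≠ f → ∀ v ∈ e, v ∉ f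
  blocked : ∀ f ∈ E, f ∉ M → ∃ b ∈ M, ρ b < ρ f ∧ ∃ v ∈ b, v ∈ f

namespace IsGreedyMatching

section Characterization

variable {V β : Type*} [LinearOrder β] {ρ : Sym2 V → β} {E M N : Finset (Sym2 V)}

theorem subset_and_subset (hM : IsGreedyMatching ρ E M)
    (hN : IsGreedyMatching ρ E N) : M ⊆ N ∧ N ⊆ M := by
  suffices h : ∀ f ∈ E, (f ∈ M ↔ f ∈ N) from
    ⟨fun f hf => (h f (hM.subset hf)).1 hf, fun f hf => (h f (hN.subset hf)).2 hf⟩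
  by_contra! hne
  have hS : (E.filter fun f => ¬ (f ∈ M ↔ f ∈ N)).Nonempty := by
    obtain ⟨f, hf, h⟩ := hne
    exact ⟨f, Finset.mem_filter.2 ⟨hf, by tauto⟩⟩
  obtain ⟨f, hf, hmin⟩ := Finset.exists_min_image _ ρ hS
  obtain ⟨hfE, hfMN⟩ := Finset.mem_filter.1 hf
  have agree : ∀ b ∈ E, ρ b < ρ f → (b ∈ M ↔ b ∈ N) := by
    intro b hb hlt
    by_contra hb'
    exact (hmin b (Finset.mem_filter.2 ⟨hb, hb'⟩)).not_gt hlt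
  by_cases hfM : f ∈ M
  · have hfN : f ∉ N := by tauto
    obtain ⟨b, hb, hlt, v, hvb, hvf⟩ := hN.blocked f hfE hfN
    exact hM.disjoint b ((agree b (hN.subset hb) hlt).2 hb) f hfM
      (fun h => hlt.ne (congrArg ρ h)) v hvb hvf
  · have hfN : f ∈ N := by tauto
    obtain ⟨b, hb, hlt, v, hvb, hvf⟩ := hM.blocked f hfE hfM
    exact hN.disjoint b ((agree b (hM.subset hb) hlt).1 hb) f hfN
      (fun h => hlt.ne (congrArg ρ h)) v hvb hvf

theorem unique (hM : IsGreedyMatching ρ E M) (hN : IsGreedyMatching ρ E N) : M = N :=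
  Finset.Subset.antisymm (hM.subset_and_subset hN).1
    (hM.subset_and_subset hN).2

theorem of_subset {E' : Finset (Sym2 V)} (hM : IsGreedyMatching ρ E M) (hE : E' ⊆ E)
    (hME : M ⊆ E') : IsGreedyMatching ρ E' M :=
  ⟨hME, hM.disjoint, fun f hf => hM.blocked f (hE hf)⟩

/-- Removing a matched edge together with its endpoints. -/
theorem erase [DecidableEq V] {u v : V} (hM : IsGreedyMatching ρ E M)
    (he : s(u, v) ∈ M) :
    IsGreedyMatching ρ ((E.filter fun f => u ∉ f).filter fun f => v ∉ f)
      (M.erase s(u, v)) where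
  subset := by
    intro f hf
    obtain ⟨hne, hf⟩ := Finset.mem_erase.1 hf
    have h := hM.disjoint _ he f hf hne.symm
    simp only [Finset.mem_filter]
    exact ⟨⟨hM.subset hf, h u (by simp)⟩, h v (by simp)⟩
  disjoint e he f hf :=
    hM.disjoint e (Finset.mem_of_mem_erase he) f (Finset.mem_of_mem_erase hf)
  blocked := by
    intro f hf hfM
    simp only [Finset.mem_filter] at hf
    obtain ⟨⟨hfE, hu⟩, hv⟩ := hf
    have hne : f ≠ s(u, v) := by
      rintro rfl
      simp at hu
    obtain ⟨b, hb, hlt, w, hwb, hwf⟩ :=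
      hM.blocked f hfE fun h => hfM (Finset.mem_erase.2 ⟨hne, h⟩)
    refine ⟨b, Finset.mem_erase.2 ⟨?_, hb⟩, hlt, w, hwb, hwf⟩
    rintro rfl
    rcases Sym2.mem_iff.1 hwb with rfl | rfl
    · exact hu hwf
    · exact hv hwf

end Characterization

section Stability

variable {V β : Type*} [Fintype V] [DecidableEq V] [LinearOrder β] {ρ : Sym2 V → β}
  {E M N : Finset (Sym2 V)}

theorem _root_.mem_matchedV_s5 {v : V} : v ∈ matchedV M ↔ ∃ e ∈ M, v ∈ e := by
  simp [matchedV]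

theorem _root_.isGreedyMatching_greedyMM (ρ : Sym2 V → β) (E : Finset (Sym2 V))
    (hρ : Set.InjOn ρ ↑E) : IsGreedyMatching ρ E (greedyMM ρ E) := by
  induction hn : E.card using Nat.strong_induction_on generalizing E with
  | _ n ih =>
  subst hn
  rw [greedyMM]
  split_ifs with h
  · have hspec := Classical.choose_spec (E.exists_min_image ρ h)
    set m := Classical.choose (E.exists_min_image ρ h)
    obtain ⟨hmE, hmin⟩ := hspec
    set E' := E.filter fun f => ¬ ∃ v, v ∈ m ∧ v ∈ f with hE'
    have hsub : E' ⊆ E := Finset.filter_subset _ _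
    have hmE' : m ∉ E' := fun hm =>
      (Finset.mem_filter.1 hm).2 ⟨m.out.1, Sym2.out_fst_mem m, Sym2.out_fst_mem m⟩
    have IH := ih E'.card
      (Finset.card_lt_card ((Finset.ssubset_iff_of_subset hsub).2 ⟨m, hmE, hmE'⟩)) E'
      (hρ.mono (by exact_mod_cast hsub)) rfl
    have far : ∀ f ∈ greedyMM ρ E', ∀ v ∈ m, v ∉ f := fun f hf v hvm hvf =>
      (Finset.mem_filter.1 (IH.subset hf)).2 ⟨v, hvm, hvf⟩
    refine ⟨?_, ?_, ?_⟩
    · intro f hf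
      rcases Finset.mem_insert.1 hf with rfl | hf
      · exact hmE
      · exact hsub (IH.subset hf)
    · intro e he f hf hne v hve hvf
      rcases Finset.mem_insert.1 he with rfl | he <;> rcases Finset.mem_insert.1 hf with rfl | hf
      · exact hne rfl
      · exact far f hf v hve hvf
      · exact far e he v hvf hve
      · exact IH.disjoint e he f hf hne v hve hvf
    · intro f hfE hf
      rw [Finset.mem_insert, not_or] at hf
      by_cases hfE' : f ∈ E'
      · obtain ⟨b, hb, hb'⟩ := IH.blocked f hfE' hf.2
        exact ⟨b, Finset.mem_insert_of_mem hb, hb'⟩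
      · have hv : ∃ v, v ∈ m ∧ v ∈ f := by
          by_contra hv
          exact hfE' (Finset.mem_filter.2 ⟨hfE, hv⟩)
        exact ⟨m, Finset.mem_insert_self _ _,
          lt_of_le_of_ne (hmin f hfE) fun h => hf.1 (hρ hmE hfE h).symm, hv⟩
  · rw [Finset.not_nonempty_iff_eq_empty] at h
    subst h
    exact ⟨by simp, by simp, by simp⟩

/-- Removing a matched edge unmatches exactly its two endpoints. -/
theorem matchedV_eq {u v : V} (hM : IsGreedyMatching ρ E M) (he : s(u, v) ∈ M)
    (huv : u ≠ v) :
    matchedV M = symmDiff (matchedV (M.erase s(u, v))) (symmDiff {u} {v}) := by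
  have hu : u ∉ matchedV (M.erase s(u, v)) := by
    simp only [mem_matchedV_s5, Finset.mem_erase, not_exists, not_and]
    exact fun f ⟨hne, hf⟩ => hM.disjoint _ he f hf hne.symm u (by simp)
  have hv : v ∉ matchedV (M.erase s(u, v)) := by
    simp only [mem_matchedV_s5, Finset.mem_erase, not_exists, not_and]
    exact fun f ⟨hne, hf⟩ => hM.disjoint _ he f hf hne.symm v (by simp)
  have key : ∀ w, w ∈ matchedV M ↔ w ∈ matchedV (M.erase s(u, v)) ∨ w = u ∨ w = v := by
    intro w
    simp only [mem_matchedV_s5, Finset.mem_erase]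
    constructor
    · rintro ⟨f, hf, hw⟩
      by_cases hfe : f = s(u, v)
      · subst hfe
        exact Or.inr (Sym2.mem_iff.1 hw)
      · exact Or.inl ⟨f, ⟨hfe, hf⟩, hw⟩
    · rintro (⟨f, ⟨-, hf⟩, hw⟩ | hw)
      · exact ⟨f, hf, hw⟩
      · exact ⟨_, he, Sym2.mem_iff.2 hw⟩
  ext w
  rw [key]
  simp only [Finset.mem_symmDiff, Finset.mem_singleton]
  by_cases h1 : w = u
  · subst h1
    tauto
  · by_cases h2 : w = v
    · subst h2
      tauto
    · tauto

/-- Deleting a vertex `v` changes the match-status of no vertex (the case `w = v`) or of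
exactly `v` and one further vertex `w`. -/
theorem exists_symmDiff_filter (hE : ∀ e ∈ E, ¬ e.IsDiag) {v : V}
    (hM : IsGreedyMatching ρ E M) (hN : IsGreedyMatching ρ (E.filter fun f => v ∉ f) N) :
    ∃ w, symmDiff (matchedV M) (matchedV N) = symmDiff {v} {w} := by
  induction hn : E.card using Nat.strong_induction_on generalizing E M N v with
  | _ n ih =>
  subst hn
  by_cases hv : v ∈ matchedV M
  · obtain ⟨e, heM, hve⟩ := mem_matchedV_s5.1 hv
    obtain ⟨u, rfl⟩ := hve
    have heE := hM.subset heM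
    have hvu : v ≠ u := by simpa using hE _ heE
    have hlt : (E.filter fun f => v ∉ f).card < E.card :=
      Finset.card_lt_card ((Finset.ssubset_iff_of_subset (Finset.filter_subset _ _)).2
        ⟨_, heE, by simp⟩)
    obtain ⟨w, hw⟩ := ih _ hlt (fun e he => hE e (Finset.mem_of_mem_filter e he)) hN
      (hM.erase heM) rfl
    refine ⟨w, ?_⟩
    rw [hM.matchedV_eq heM hvu, symmDiff_comm, ← symmDiff_assoc, hw,
      symmDiff_comm, symmDiff_assoc, symmDiff_symmDiff_cancel_left]
  · have hsub : M ⊆ E.filter fun f => v ∉ f := fun f hf =>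
      Finset.mem_filter.2 ⟨hM.subset hf, fun h => hv (mem_matchedV_s5.2 ⟨f, hf, h⟩)⟩
    rw [(hM.of_subset (Finset.filter_subset _ _) hsub).unique hN]
    exact ⟨v, by simp⟩

theorem _root_.statusDiff_eq_card_symmDiff (M N : Finset (Sym2 V)) :
    statusDiff M N = (symmDiff (matchedV M) (matchedV N)).card := by
  unfold statusDiff
  congr 1
  ext v
  simp only [Finset.mem_filter, Finset.mem_univ, true_and, Finset.mem_symmDiff]
  tauto

theorem _root_.statusDiff_comm (M N : Finset (Sym2 V)) : statusDiff M N = statusDiff N M := by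
  rw [statusDiff_eq_card_symmDiff, statusDiff_eq_card_symmDiff, symmDiff_comm]

/-- Deleting an edge changes the match-status of at most two vertices. -/
theorem statusDiff_erase_le_two (hE : ∀ e ∈ E, ¬ e.IsDiag) (hρ : Set.InjOn ρ ↑E)
    {e : Sym2 V} (hM : IsGreedyMatching ρ E M) (hN : IsGreedyMatching ρ (E.erase e) N) :
    statusDiff M N ≤ 2 := by
  rw [statusDiff_eq_card_symmDiff]
  by_cases he : e ∈ M
  · induction e using Sym2.ind with
    | _ u v =>
    have huv : u ≠ v := by simpa using hE _ (hM.subset he)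
    have hfilter : ((E.erase s(u, v)).filter fun f => u ∉ f) = E.filter fun f => u ∉ f := by
      ext f
      simp only [Finset.mem_filter, Finset.mem_erase]
      refine ⟨fun h => ⟨h.1.2, h.2⟩, fun h => ⟨⟨?_, h.1⟩, h.2⟩⟩
      rintro rfl
      simp at h
    have hL := isGreedyMatching_greedyMM ρ (E.filter fun f => u ∉ f)
      (hρ.mono (by exact_mod_cast Finset.filter_subset _ _))
    obtain ⟨y, hy⟩ := hL.exists_symmDiff_filter
      (fun e he => hE e (Finset.mem_of_mem_filter e he)) (hM.erase he)
    rw [← hfilter] at hL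
    obtain ⟨x, hx⟩ := hN.exists_symmDiff_filter
      (fun e he => hE e (Finset.mem_of_mem_erase he)) hL
    rw [hfilter] at hx
    have hxy : symmDiff (matchedV M) (matchedV N) = symmDiff {x} {y} := by
      have h : symmDiff (matchedV N) (matchedV (M.erase s(u, v))) =
          symmDiff (symmDiff {u} {v}) (symmDiff {x} {y}) := by
        rw [symmDiff_symmDiff_symmDiff_comm, ← hx, ← hy, symmDiff_assoc,
          symmDiff_symmDiff_cancel_left]
      rw [hM.matchedV_eq he huv, symmDiff_comm, ← symmDiff_assoc, h, symmDiff_comm,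
        symmDiff_symmDiff_cancel_left]
    rw [hxy]
    refine (Finset.card_le_card (t := {x, y}) ?_).trans Finset.card_le_two
    intro w
    simp only [Finset.mem_symmDiff, Finset.mem_insert, Finset.mem_singleton]
    tauto
  · have hsub : M ⊆ E.erase e := fun f hf =>
      Finset.mem_erase.2 ⟨fun h => he (h ▸ hf), hM.subset hf⟩
    rw [(hM.of_subset (Finset.erase_subset _ _) hsub).unique hN]
    simp

/-- Raising the priority value of a single edge changes at most two match-statuses. -/
theorem statusDiff_le_two_of_le {ρ' : Sym2 V → β} (hE : ∀ e ∈ E, ¬ e.IsDiag)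
    (hρ : Set.InjOn ρ ↑E) {e₀ : Sym2 V} (hchange : ∀ e, e ≠ e₀ → ρ' e = ρ e)
    (hle : ρ e₀ ≤ ρ' e₀) (hM : IsGreedyMatching ρ E M) (hN : IsGreedyMatching ρ' E N) :
    statusDiff M N ≤ 2 := by
  have hle' : ∀ e, ρ e ≤ ρ' e := by
    intro e
    by_cases h : e = e₀
    · exact h ▸ hle
    · exact (hchange e h).ge
  have lower : ∀ f, f ≠ e₀ → f ∈ E → f ∉ N → ∃ b ∈ N, ρ b < ρ f ∧ ∃ v ∈ b, v ∈ f := by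
    intro f hne hf hfN
    obtain ⟨b, hb, hlt, hv⟩ := hN.blocked f hf hfN
    exact ⟨b, hb, (hle' b).trans_lt (hchange f hne ▸ hlt), hv⟩
  by_cases he : e₀ ∈ N
  · have hN' : IsGreedyMatching ρ E N :=
      ⟨hN.subset, hN.disjoint, fun f hf hfN => lower f (fun h => hfN (h ▸ he)) hf hfN⟩
    rw [hM.unique hN', statusDiff_eq_card_symmDiff]
    simp
  · refine hM.statusDiff_erase_le_two hE hρ (e := e₀) ⟨?_, hN.disjoint, ?_⟩
    · exact fun f hf => Finset.mem_erase.2 ⟨fun h => he (h ▸ hf), hN.subset hf⟩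
    · exact fun f hf => lower f (Finset.ne_of_mem_erase hf) (Finset.mem_of_mem_erase hf)

end Stability

end IsGreedyMatching

/-- **Stability of greedy matching under a single priority change** (Lemma A.2, part 3).
Fix a graph `G = (V, E)` and an injective priority assignment `ρ : E → [0,1]`.  If the
injective priority assignment `ρ'` is obtained from `ρ` by changing the value of a single
edge `e₀`, then there are at most `2` vertices whose match-status differs between
`GreedyMM(G, ρ)` and `GreedyMM(G, ρ')`. -/
theorem greedy_matching_priority_change_stability
    {V : Type*} [Fintype V] [DecidableEq V]
    (E : Finset (Sym2 V)) (hE : ∀ e ∈ E, ¬ e.IsDiag)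
    (ρ ρ' : Sym2 V → ℝ)
    (hρ01 : ∀ e ∈ E, ρ e ∈ Set.Icc (0 : ℝ) 1) (hρ'01 : ∀ e ∈ E, ρ' e ∈ Set.Icc (0 : ℝ) 1)
    (hρ : Set.InjOn ρ ↑E) (hρ' : Set.InjOn ρ' ↑E)
    (e₀ : Sym2 V) (he₀ : e₀ ∈ E) (hchange : ∀ e, e ≠ e₀ → ρ' e = ρ e) :
    statusDiff (greedyMM ρ E) (greedyMM ρ' E) ≤ 2 := by
  have hM := isGreedyMatching_greedyMM ρ E hρ
  have hN := isGreedyMatching_greedyMM ρ' E hρ'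
  rcases le_total (ρ e₀) (ρ' e₀) with h | h
  · exact hM.statusDiff_le_two_of_le hE hρ hchange h hN
  · rw [statusDiff_comm]
    exact hN.statusDiff_le_two_of_le hE hρ' (fun e he => (hchange e he).symm) h hM
end

section
/- Fix a graph G = (V, E), an injective priority assignment ρ : E → [0,1], a vertex v, and let G' be the graph obtained from G by removing v. Let D = M ⊕ M' be the symmetric difference of M = GreedyMM(G, ρ) and M' = GreedyMM(G', ρ). Then D has at most one connected component containing an edge, and this component is a path or a cycle. -/
open Finset
open scoped Classical

section GreedyMM

variable {V β : Type*} [Fintype V] [DecidableEq V] [LinearOrder β]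

/-- One step of the greedy algorithm: a nonempty edge set has an edge `e` of minimum priority
which is matched first, after which the algorithm continues on the edges disjoint from `e`. -/
theorem greedyMM_eq_insert (ρ : Sym2 V → β) {E : Finset (Sym2 V)} (h : E.Nonempty) :
    ∃ e ∈ E, (∀ f ∈ E, ρ e ≤ ρ f) ∧
      greedyMM ρ E = insert e (greedyMM ρ (E.filter fun f => ¬ ∃ v, v ∈ e ∧ v ∈ f)) := by
  have hspec := Classical.choose_spec (E.exists_min_image ρ h)
  refine ⟨Classical.choose (E.exists_min_image ρ h), hspec.1, hspec.2, ?_⟩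
  conv_lhs => rw [greedyMM]
  rw [dif_pos h]

theorem greedyMM_empty (ρ : Sym2 V → β) : greedyMM ρ (∅ : Finset (Sym2 V)) = ∅ := by
  rw [greedyMM, dif_neg Finset.not_nonempty_empty]

/-- Induction along the greedy algorithm. -/
theorem greedyMM_induction (ρ : Sym2 V → β) {p : Finset (Sym2 V) → Finset (Sym2 V) → Prop}
    (empty : p ∅ ∅)
    (step : ∀ E, ∀ e ∈ E, (∀ f ∈ E, ρ e ≤ ρ f) → ∀ M,
      p (E.filter fun f => ¬ ∃ v, v ∈ e ∧ v ∈ f) M → p E (insert e M))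
    (E : Finset (Sym2 V)) : p E (greedyMM ρ E) := by
  induction E using Finset.strongInduction with
  | H E ih =>
    rcases E.eq_empty_or_nonempty with rfl | hne
    · rwa [greedyMM_empty]
    · obtain ⟨e, he, hmin, heq⟩ := greedyMM_eq_insert ρ hne
      rw [heq]
      refine step E e he hmin _ (ih _ ?_)
      exact Finset.filter_ssubset.2
        ⟨e, he, not_not.2 ⟨e.out.1, Sym2.out_fst_mem e, Sym2.out_fst_mem e⟩⟩

theorem greedyMM_subset (ρ : Sym2 V → β) (E : Finset (Sym2 V)) : greedyMM ρ E ⊆ E :=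
  greedyMM_induction ρ (p := fun E M => M ⊆ E) subset_rfl
    (fun _ _ he _ _ hM => Finset.insert_subset he (hM.trans (Finset.filter_subset _ _))) E

/-- Edges of the greedy matching that share a vertex are equal. -/
theorem greedyMM_eq_of_mem (ρ : Sym2 V → β) (E : Finset (Sym2 V)) {e f : Sym2 V}
    (he : e ∈ greedyMM ρ E) (hf : f ∈ greedyMM ρ E) {v : V} (hve : v ∈ e) (hvf : v ∈ f) :
    e = f := by
  suffices h : greedyMM ρ E ⊆ E ∧ ∀ e ∈ greedyMM ρ E, ∀ f ∈ greedyMM ρ E,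
      ∀ v, v ∈ e → v ∈ f → e = f from h.2 e he f hf v hve hvf
  refine greedyMM_induction ρ
    (p := fun E M => M ⊆ E ∧ ∀ e ∈ M, ∀ f ∈ M, ∀ v, v ∈ e → v ∈ f → e = f)
    (by simp) ?_ E
  rintro E g hg - M ⟨hsub, hM⟩
  refine ⟨Finset.insert_subset hg (hsub.trans (Finset.filter_subset _ _)), ?_⟩
  have hdisj : ∀ f ∈ M, ∀ v, v ∈ g → v ∉ f := fun f hf v hvg hvf =>
    (Finset.mem_filter.1 (hsub hf)).2 ⟨v, hvg, hvf⟩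
  intro e he f hf v hve hvf
  rcases Finset.mem_insert.1 he with rfl | heM <;> rcases Finset.mem_insert.1 hf with rfl | hfM
  · rfl
  · exact absurd hvf (hdisj f hfM v hve)
  · exact absurd hve (hdisj e heM v hvf)
  · exact hM e heM f hfM v hve hvf

/-- Every edge meets an edge of the greedy matching of at most its own priority. -/
theorem exists_mem_greedyMM_le (ρ : Sym2 V → β) (E : Finset (Sym2 V)) :
    ∀ e ∈ E, ∃ f ∈ greedyMM ρ E, ρ f ≤ ρ e ∧ ∃ v, v ∈ f ∧ v ∈ e := by
  refine greedyMM_induction ρ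
    (p := fun E M => ∀ e ∈ E, ∃ f ∈ M, ρ f ≤ ρ e ∧ ∃ v, v ∈ f ∧ v ∈ e) (by simp) ?_ E
  intro E g _ hmin M hM e he
  by_cases h : ∃ v, v ∈ g ∧ v ∈ e
  · exact ⟨g, Finset.mem_insert_self _ _, hmin e he, h⟩
  · obtain ⟨f, hf, hfe⟩ := hM e (Finset.mem_filter.2 ⟨he, h⟩)
    exact ⟨f, Finset.mem_insert_of_mem hf, hfe⟩

/-- An edge that is not matched meets a matched edge of smaller priority. -/
theorem exists_mem_greedyMM_lt (ρ : Sym2 V → β) {E : Finset (Sym2 V)} (hρ : Set.InjOn ρ ↑E)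
    {e : Sym2 V} (he : e ∈ E) (heM : e ∉ greedyMM ρ E) :
    ∃ f ∈ greedyMM ρ E, ρ f < ρ e ∧ ∃ v, v ∈ f ∧ v ∈ e := by
  obtain ⟨f, hf, hle, hv⟩ := exists_mem_greedyMM_le ρ E e he
  refine ⟨f, hf, lt_of_le_of_ne hle fun h => heM ?_, hv⟩
  rwa [← hρ (greedyMM_subset ρ E hf) he h]

theorem card_filter_mem_greedyMM_le_one (ρ : Sym2 V → β) (E : Finset (Sym2 V)) (v : V) :
    ((greedyMM ρ E).filter fun e => v ∈ e).card ≤ 1 := by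
  refine Finset.card_le_one.2 fun e he f hf => ?_
  rw [Finset.mem_filter] at he hf
  exact greedyMM_eq_of_mem ρ E he.1 hf.1 he.2 hf.2

end GreedyMM

/-- Two endpoints of an edge of `S` are connected in the graph with edge set `S`. -/
theorem reachable_fromEdgeSet_of_mem {V : Type*} {S : Set (Sym2 V)} {e : Sym2 V} (he : e ∈ S)
    {u w : V} (hu : u ∈ e) (hw : w ∈ e) : (SimpleGraph.fromEdgeSet S).Reachable u w := by
  by_cases huw : u = w
  · exact huw ▸ SimpleGraph.Reachable.refl u
  · refine SimpleGraph.Adj.reachable ((SimpleGraph.fromEdgeSet_adj S).2 ⟨?_, huw⟩)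
    rwa [← (Sym2.mem_and_mem_iff huw).1 ⟨hu, hw⟩]

/-- Every edge of the symmetric difference of the greedy matchings with and without `v₀` is
connected to `v₀` inside that symmetric difference. -/
theorem reachable_of_mem_greedyMM_symmDiff {V β : Type*} [Fintype V] [DecidableEq V]
    [LinearOrder β] (ρ : Sym2 V → β) {E E' D : Finset (Sym2 V)} (hρ : Set.InjOn ρ ↑E) {v₀ : V}
    (hE' : ∀ e, e ∈ E' ↔ e ∈ E ∧ v₀ ∉ e)
    (hD : ∀ e, e ∈ D ↔ e ∈ greedyMM ρ E ∧ e ∉ greedyMM ρ E' ∨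
      e ∈ greedyMM ρ E' ∧ e ∉ greedyMM ρ E)
    {e : Sym2 V} (he : e ∈ D) {u : V} (hu : u ∈ e) :
    (SimpleGraph.fromEdgeSet (↑D : Set (Sym2 V))).Reachable v₀ u := by
  have hsub : E' ⊆ E := fun e he => ((hE' e).1 he).1
  have hwf : WellFounded fun e f : {e // e ∈ D} => ρ e < ρ f :=
    Finite.wellFounded_of_trans_of_irrefl _
  suffices h : ∀ x : {e // e ∈ D}, ∀ u ∈ x.1,
      (SimpleGraph.fromEdgeSet (↑D : Set (Sym2 V))).Reachable v₀ u from h ⟨e, he⟩ u hu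
  intro x
  induction x using hwf.induction with
  | _ x ih =>
    obtain ⟨e, he⟩ := x
    intro u hu
    by_cases hv : v₀ ∈ e
    · exact reachable_fromEdgeSet_of_mem he hv hu
    · obtain ⟨f, hf, hlt, w, hwf, hwe⟩ : ∃ f ∈ D, ρ f < ρ e ∧ ∃ v, v ∈ f ∧ v ∈ e := by
        rcases (hD e).1 he with ⟨h, h'⟩ | ⟨h, h'⟩
        · obtain ⟨f, hf, hlt, w, hwf, hwe⟩ := exists_mem_greedyMM_lt ρ
            (hρ.mono (Finset.coe_subset.2 hsub)) ((hE' e).2 ⟨greedyMM_subset ρ E h, hv⟩) h'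
          refine ⟨f, (hD f).2 (.inr ⟨hf, fun hfM => hlt.ne ?_⟩), hlt, w, hwf, hwe⟩
          rw [greedyMM_eq_of_mem ρ E hfM h hwf hwe]
        · obtain ⟨f, hf, hlt, w, hwf, hwe⟩ := exists_mem_greedyMM_lt ρ hρ
            (hsub (greedyMM_subset ρ E' h)) h'
          refine ⟨f, (hD f).2 (.inl ⟨hf, fun hfM => hlt.ne ?_⟩), hlt, w, hwf, hwe⟩
          rw [greedyMM_eq_of_mem ρ E' hfM h hwf hwe]
      exact (ih ⟨f, hf⟩ hlt w hwf).trans (reachable_fromEdgeSet_of_mem he hwe hu)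

/-- **Structure of the symmetric difference of two greedy matchings** (from the proof of
Lemma A.2).  Fix a graph `G = (V, E)`, an injective priority assignment `ρ : E → [0,1]`,
and a vertex `v₀`, and let `G'` be obtained from `G` by removing `v₀`.  Let
`D = M ⊕ M'` be the symmetric difference of `M = GreedyMM(G, ρ)` and
`M' = GreedyMM(G', ρ)`.  Then `D` has at most one connected component containing an edge
(any two endpoints of edges of `D` are joined by a path in `D`), and this component is a
path or a cycle (equivalently, being connected, every vertex has degree at most `2` in `D`). -/
theorem greedy_matching_symmDiff_structure
    {V : Type*} [Fintype V] [DecidableEq V]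
    (E : Finset (Sym2 V)) (hE : ∀ e ∈ E, ¬ e.IsDiag)
    (ρ : Sym2 V → ℝ) (hρ01 : ∀ e ∈ E, ρ e ∈ Set.Icc (0 : ℝ) 1) (hρ : Set.InjOn ρ ↑E)
    (v₀ : V)
    (M M' D : Finset (Sym2 V))
    (hM : M = greedyMM ρ E) (hM' : M' = greedyMM ρ (E.filter fun e => v₀ ∉ e))
    (hD : D = (M \ M') ∪ (M' \ M)) :
    (∀ e ∈ D, ∀ e' ∈ D, ∀ u ∈ e, ∀ u' ∈ e',
        (SimpleGraph.fromEdgeSet (↑D : Set (Sym2 V))).Reachable u u') ∧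
      (∀ v : V, (D.filter fun e => v ∈ e).card ≤ 2) := by
  have hmem : ∀ e, e ∈ D ↔ e ∈ M ∧ e ∉ M' ∨ e ∈ M' ∧ e ∉ M := by
    intro e
    rw [hD, Finset.mem_union, Finset.mem_sdiff, Finset.mem_sdiff]
  constructor
  · have hreach : ∀ e ∈ D, ∀ u ∈ e,
        (SimpleGraph.fromEdgeSet (↑D : Set (Sym2 V))).Reachable v₀ u := by
      subst hM hM'
      exact fun e he u hu => reachable_of_mem_greedyMM_symmDiff ρ hρ
        (fun e => Finset.mem_filter) hmem he hu
    exact fun e he e' he' u hu u' hu' => (hreach e he u hu).symm.trans (hreach e' he' u' hu')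
  · intro v
    have hsub : (D.filter fun e => v ∈ e) ⊆
        (M.filter fun e => v ∈ e) ∪ (M'.filter fun e => v ∈ e) := by
      intro e
      simp only [Finset.mem_union, Finset.mem_filter, hmem]
      tauto
    have h₁ : (M.filter fun e => v ∈ e).card ≤ 1 :=
      hM ▸ card_filter_mem_greedyMM_le_one ρ E v
    have h₂ : (M'.filter fun e => v ∈ e).card ≤ 1 :=
      hM' ▸ card_filter_mem_greedyMM_le_one ρ _ v
    exact (Finset.card_le_card hsub).trans ((Finset.card_union_le _ _).trans (by omega))
end

section
/- Let G be a graph with m edges and r pairs of intersecting edges (pairs of distinct edges sharing an endpoint). If π is a permutation of the edges drawn uniformly at random, then E_π[ Σ_{e ∈ E} A(e) ] ≤ m + 2r, where A(e) denotes the total number of recursive calls to EdgeOracle_π generated by running EdgeOracle_π(e). -/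
open Finset
open scoped Classical

section Defs

variable {V : Type*} [Fintype V] [DecidableEq V]

/-- The endpoints of an edge, as a finset. -/
noncomputable def ends (e : Sym2 V) : Finset V := Finset.univ.filter (· ∈ e)

/-- The recursive edge oracle (with bookkeeping), for the graph with (sampled) edge set `L`
and priorities `π`, run with the partition-indicator vector `x`.
`eoQ π L x fuel e` returns a triple `(ans, qs, cnt)` where `ans` tells whether `e` joins the
greedy matching of the induced subgraph of `L` on `{v | x v}`, `qs` is the set of entries of
`x` queried, and `cnt` is the number of (recursive) oracle calls made on edges of `L` having
both endpoints in `{v | x v}` (including the call on `e` itself, when applicable).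
The oracle first queries the two endpoints of `e` and answers NO if one of them is outside
the part; otherwise it recursively evaluates the incident edges of `L` of smaller priority,
in increasing order of priority, stopping as soon as one of them answers YES.
It is always invoked with `fuel = π e + 1`, which guarantees the fuel never runs out. -/
noncomputable def eoQ (π : Sym2 V → ℕ) (L : Finset (Sym2 V)) (x : V → Bool) :
    ℕ → Sym2 V → Bool × Finset V × ℕ
  | 0, e => (false, ends e, 0)
  | fuel + 1, e =>
    if ∀ v ∈ e, x v then
      let nbrs := ((L.filter fun f => f ≠ e ∧ (∃ v, v ∈ e ∧ v ∈ f) ∧ π f < π e).toList.mergeSort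
          (fun a b => decide (π a ≤ π b)))
      let r := nbrs.foldl (fun (s : Bool × Finset V × ℕ) f =>
          if s.1 then s
          else
            let t := eoQ π L x fuel f
            (t.1, s.2.1 ∪ t.2.1, s.2.2 + t.2.2)) (false, ∅, 0)
      (!r.1, ends e ∪ r.2.1, (if e ∈ L then 1 else 0) + r.2.2)
    else (false, ends e, 0)

/-- Whether `e` belongs to the greedy matching, as decided by the edge oracle. -/
noncomputable def edgeOracle (π : Sym2 V → ℕ) (L : Finset (Sym2 V)) (x : V → Bool)
    (e : Sym2 V) : Bool × Finset V × ℕ :=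
  eoQ π L x (π e + 1) e

/-- The degree oracle for vertex `v`: determines `Z_{v,1}`, the number of neighbors of `v`
(in the graph with edge set `Ed`) lying in the part `{u | x u}` that are unmatched in the
greedy matching of the induced subgraph of `L`.  For each neighbor `u` of `v` it queries
`x u`, and if `x u = 1`, it runs the edge oracle on every edge of `L` incident to `u`.
Returns `(Z value, set of entries of x queried, number of oracle calls on edges inside the part)`. -/
noncomputable def degOr (Ed : Finset (Sym2 V)) (π : Sym2 V → ℕ) (L : Finset (Sym2 V))
    (x : V → Bool) (v : V) : ℕ × Finset V × ℕ :=
  let Nv := Finset.univ.filter fun u => s(u, v) ∈ Ed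
  let q := Nv ∪ (Nv.filter fun u => x u).biUnion fun u =>
      (Finset.univ.filter fun w => s(u, w) ∈ L).biUnion fun w =>
        (edgeOracle π L x s(u, w)).2.1
  let c := ∑ u ∈ Nv.filter (fun u => x u), ∑ w ∈ Finset.univ.filter (fun w => s(u, w) ∈ L),
        (edgeOracle π L x s(u, w)).2.2
  ((Nv.filter fun u => x u ∧ ∀ w ∈ Finset.univ.filter (fun w => s(u, w) ∈ L),
      (edgeOracle π L x s(u, w)).1 = false).card, q, c)

/-- `B v`: the number of entries of `x` queried during the execution of the degree oracle. -/
noncomputable def Bqueries (Ed : Finset (Sym2 V)) (π : Sym2 V → ℕ) (L : Finset (Sym2 V))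
    (x : V → Bool) (v : V) : ℕ :=
  (degOr Ed π L x v).2.1.card

/-- The priority function on edges induced by a permutation `τ` of `Fin E.card`,
via the canonical enumeration of `E`; edges outside `E` get priority `0`. -/
noncomputable def prioOf (E : Finset (Sym2 V)) (τ : Equiv.Perm (Fin E.card)) (e : Sym2 V) : ℕ :=
  if h : e ∈ E then (τ (E.equivFin ⟨e, h⟩) : ℕ) else 0

/-- `L₁`: the set of edges of `L` with both endpoints inside the part `{v | x v}`. -/
noncomputable def partEdges (L : Finset (Sym2 V)) (x : V → Bool) : Finset (Sym2 V) :=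
  L.filter fun e => ∀ v ∈ e, x v

/-- `Z_{v,1}(x)`: the number of neighbors of `v` in the graph `Ed` lying in the part
`{u | x u}` that are unmatched in `M₁ = GreedyMM(L₁, π)`. -/
noncomputable def Zv1 (Ed : Finset (Sym2 V)) (π : Sym2 V → ℕ) (L : Finset (Sym2 V))
    (x : V → Bool) (v : V) : ℕ :=
  (Finset.univ.filter fun u =>
    s(u, v) ∈ Ed ∧ x u ∧ u ∉ matchedV (greedyMM π (partEdges L x))).card

end Defs

section RandomGreedy

variable {α : Type*} [DecidableEq α]

/-- The duplicate-free lists of length `n` with entries in `R`. -/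
def orderings : ℕ → Finset α → Finset (List α)
  | 0, _ => {[]}
  | n + 1, R => R.biUnion fun w => (orderings n (R.erase w)).image (List.cons w)

lemma mem_orderings {l : List α} {R : Finset α} (hl : l.Nodup) (hR : ∀ a ∈ l, a ∈ R) :
    l ∈ orderings l.length R := by
  induction l generalizing R with
  | nil => simp [orderings]
  | cons w l ih =>
    obtain ⟨hw, hl⟩ := List.nodup_cons.1 hl
    refine mem_biUnion.2 ⟨w, hR w (by simp), mem_image_of_mem _ (ih hl fun a ha => ?_)⟩
    exact mem_erase.2 ⟨fun h => hw (h ▸ ha), hR a (by simp [ha])⟩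

lemma sum_orderings_succ (n : ℕ) (R : Finset α) (g : List α → ℕ) :
    ∑ l ∈ orderings (n + 1) R, g l =
      ∑ w ∈ R, ∑ l ∈ orderings n (R.erase w), g (w :: l) := by
  rw [orderings, sum_biUnion]
  · refine sum_congr rfl fun w _ => sum_image fun a _ b _ h => ?_
    exact List.tail_eq_of_cons_eq h
  · intro w _ w' _ hne
    refine disjoint_left.2 fun l hl hl' => hne ?_
    obtain ⟨a, -, rfl⟩ := mem_image.1 hl
    obtain ⟨b, -, hb⟩ := mem_image.1 hl'
    exact (List.head_eq_of_cons_eq hb).symm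

lemma card_orderings {n : ℕ} {R : Finset α} (hR : R.card = n) :
    (orderings n R).card = n.factorial := by
  induction n generalizing R with
  | zero => simp [orderings]
  | succ n ih =>
    rw [card_eq_sum_ones, sum_orderings_succ]
    have h : ∀ w ∈ R, ∑ l ∈ orderings n (R.erase w), 1 = n.factorial := fun w hw => by
      rw [← card_eq_sum_ones, ih (by rw [card_erase_of_mem hw, hR]; rfl)]
    rw [sum_congr rfl h, sum_const, hR, smul_eq_mul, Nat.factorial_succ]

/-- One step of the scan over the lower-ranked neighbours of an element: `s` records whether a
neighbour in the greedy independent set has been found and the number of calls made so far,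
`t` is the outcome of the call on the next neighbour. -/
def scanStep (s t : Bool × ℕ) : Bool × ℕ := if s.1 then s else (t.1, s.2 + t.2)

/-- The outcome of a call, given the final state of the scan over the neighbours. -/
def scanResult (s : Bool × ℕ) : Bool × ℕ := (!s.1, 1 + s.2)

variable (adj : α → α → Prop) [DecidableRel adj]

/-- Update of the scan states of all elements when `w` is the next element of the order. -/
def scanUpdate (w : α) (S : α → Bool × ℕ) (u : α) : Bool × ℕ :=
  if adj u w then scanStep (S u) (scanResult (S w)) else S u

/-- The number of calls made by the oracle when started once from each element of a list,
where `S` holds the scan states due to the elements preceding the list. -/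
def totalCalls : List α → (α → Bool × ℕ) → ℕ
  | [], _ => 0
  | w :: l, S => 1 + (S w).2 + totalCalls l (scanUpdate adj w S)

omit [DecidableEq α] in
lemma totalCalls_eq_sum {o : α → Bool × ℕ} {l : List α}
    (ho : ∀ pre w suf, l = pre ++ w :: suf → o w =
      scanResult ((pre.filter fun f => adj w f).foldl (fun s f => scanStep s (o f)) (false, 0))) :
    totalCalls adj l (fun _ => (false, 0)) = (l.map fun w => (o w).2).sum := by
  suffices h : ∀ (suf pre : List α) (S : α → Bool × ℕ), l = pre ++ suf →
      (∀ u, S u = (pre.filter fun f => adj u f).foldl (fun s f => scanStep s (o f)) (false, 0)) →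
      totalCalls adj suf S = (suf.map fun w => (o w).2).sum from
    h l [] _ rfl fun u => by simp
  intro suf
  induction suf with
  | nil => intros; simp [totalCalls]
  | cons w suf ih =>
    intro pre S hl hS
    have hw : scanResult (S w) = o w := by rw [ho pre w suf hl, hS w]
    rw [totalCalls, ih (pre ++ [w]) _ (by simpa using hl), List.map_cons, List.sum_cons, ← hw]
    · rfl
    · intro u
      by_cases h : adj u w <;> simp [scanUpdate, h, hw, List.filter_append, hS u]

/-- The potential of a state: pending calls from `u`, weighted by the number of its
neighbours in `R` that are not yet dominated. -/
def potential (R : Finset α) (S : α → Bool × ℕ) : ℕ :=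
  ∑ u ∈ R, ∑ v ∈ R, if adj u v ∧ (S v).1 = false then 1 + (S u).2 else 0

variable {adj}

lemma sum_cost_scanUpdate (hsymm : ∀ a b, adj a b → adj b a) (hirr : ∀ a, ¬ adj a a)
    (R : Finset α) (S : α → Bool × ℕ) :
    ∑ w ∈ R, (1 + (S w).2 + ∑ u ∈ R.erase w, (1 + (scanUpdate adj w S u).2)) =
      R.card * ∑ u ∈ R, (1 + (S u).2) + potential adj R S := by
  have hstep : ∀ w u, 1 + (scanUpdate adj w S u).2 =
      1 + (S u).2 + if adj w u ∧ (S u).1 = false then 1 + (S w).2 else 0 := by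
    intro w u
    by_cases h : adj u w
    · have h' := hsymm _ _ h
      cases hu : (S u).1 <;> simp [scanUpdate, scanStep, scanResult, h, h', hu, add_assoc]
    · have h' : ¬ adj w u := fun h' => h (hsymm _ _ h')
      simp [scanUpdate, h, h']
  have hw : ∀ w ∈ R, 1 + (S w).2 + ∑ u ∈ R.erase w, (1 + (scanUpdate adj w S u).2) =
      ∑ u ∈ R, (1 + (S u).2) +
        ∑ u ∈ R, if adj w u ∧ (S u).1 = false then 1 + (S w).2 else 0 := by
    intro w hw
    rw [sum_congr rfl fun u _ => hstep w u, sum_add_distrib, ← add_assoc,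
      add_sum_erase R (fun u => 1 + (S u).2) hw]
    congr 1
    exact sum_erase _ (by simp [hirr])
  rw [sum_congr rfl hw, sum_add_distrib, sum_const, smul_eq_mul, potential]

lemma sum_potential_scanUpdate_le (hsymm : ∀ a b, adj a b → adj b a) (hirr : ∀ a, ¬ adj a a)
    (R : Finset α) (S : α → Bool × ℕ) :
    ∑ w ∈ R, potential adj (R.erase w) (scanUpdate adj w S) ≤
      (R.card - 1) * potential adj R S := by
  set pathWeight : α → α → α → ℕ := fun a b c =>
    if adj a b ∧ adj b c ∧ a ≠ c ∧ (S b).1 = false ∧ (S c).1 = false then 1 + (S a).2 else 0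
    with hpath
  have hpt : ∀ w u v,
      (if u ≠ w ∧ v ≠ w then
        (if adj u v ∧ (scanUpdate adj w S v).1 = false then 1 + (scanUpdate adj w S u).2 else 0)
        else 0) + pathWeight u v w ≤
      (if u ≠ w then (if adj u v ∧ (S v).1 = false then 1 + (S u).2 else 0) else 0) +
        pathWeight w u v := by
    intro w u v
    by_cases huw : u = w
    · subst huw; simp [hpath]
    by_cases hvw : v = w
    · subst hvw; simp [hpath, hirr]
    by_cases h1 : adj u v
    swap
    · simp [hpath, h1]
    have hc : adj w u ↔ adj u w := ⟨hsymm _ _, hsymm _ _⟩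
    by_cases h2 : adj u w <;> by_cases h3 : adj v w <;> cases h4 : (S u).1 <;>
      cases h5 : (S v).1 <;> cases h6 : (S w).1 <;>
      simp [hpath, huw, hvw, h1, hc, h2, h3, h4, h5, h6, scanUpdate, scanStep, scanResult,
        Ne.symm hvw, add_assoc]
  have hlhs : ∀ w ∈ R, potential adj (R.erase w) (scanUpdate adj w S) =
      ∑ u ∈ R, ∑ v ∈ R, if u ≠ w ∧ v ≠ w then
        (if adj u v ∧ (scanUpdate adj w S v).1 = false then 1 + (scanUpdate adj w S u).2 else 0)
        else 0 := by
    intro w _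
    rw [potential, ← filter_ne' R w, sum_filter]
    refine sum_congr rfl fun u _ => ?_
    by_cases hu : u = w
    · simp [hu]
    · simp [hu, sum_filter]
  have hrhs : ∑ w ∈ R, ∑ u ∈ R, ∑ v ∈ R,
      (if u ≠ w then (if adj u v ∧ (S v).1 = false then 1 + (S u).2 else 0) else 0) =
      (R.card - 1) * potential adj R S := by
    rw [sum_comm, potential, mul_sum]
    refine sum_congr rfl fun u hu => ?_
    rw [sum_comm, mul_sum]
    refine sum_congr rfl fun v _ => ?_
    rw [← sum_filter, filter_ne, sum_const, card_erase_of_mem hu, smul_eq_mul]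
  have hrot : ∑ w ∈ R, ∑ u ∈ R, ∑ v ∈ R, pathWeight u v w =
      ∑ w ∈ R, ∑ u ∈ R, ∑ v ∈ R, pathWeight w u v := by
    rw [sum_comm]
    exact sum_congr rfl fun u _ => sum_comm
  have hsum := sum_le_sum fun w (_ : w ∈ R) => sum_le_sum fun u (_ : u ∈ R) =>
    sum_le_sum fun v (_ : v ∈ R) => hpt w u v
  simp only [sum_add_distrib] at hsum
  rw [hrhs, hrot] at hsum
  rw [sum_congr rfl hlhs]
  exact Nat.le_of_add_le_add_right hsum

lemma sum_totalCalls_le (hsymm : ∀ a b, adj a b → adj b a) (hirr : ∀ a, ¬ adj a a)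
    {n : ℕ} {R : Finset α} (hR : R.card = n) (S : α → Bool × ℕ) :
    ∑ l ∈ orderings n R, totalCalls adj l S ≤
      n.factorial * (∑ u ∈ R, (1 + (S u).2) + potential adj R S) := by
  induction n generalizing R S with
  | zero => simp [orderings, totalCalls]
  | succ n ih =>
    have hcard : ∀ w ∈ R, (R.erase w).card = n := fun w hw => by
      rw [card_erase_of_mem hw, hR]; rfl
    calc ∑ l ∈ orderings (n + 1) R, totalCalls adj l S
        = ∑ w ∈ R, ∑ l ∈ orderings n (R.erase w),
            (1 + (S w).2 + totalCalls adj l (scanUpdate adj w S)) := sum_orderings_succ _ _ _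
      _ ≤ ∑ w ∈ R, n.factorial * (1 + (S w).2 + ∑ u ∈ R.erase w, (1 + (scanUpdate adj w S u).2) +
            potential adj (R.erase w) (scanUpdate adj w S)) := by
          refine sum_le_sum fun w hw => ?_
          rw [sum_add_distrib, sum_const, card_orderings (hcard w hw), smul_eq_mul,
            add_assoc (1 + (S w).2), mul_add n.factorial (1 + (S w).2)]
          exact Nat.add_le_add_left (ih (hcard w hw) _) _
      _ = n.factorial * (R.card * ∑ u ∈ R, (1 + (S u).2) + potential adj R S +
            ∑ w ∈ R, potential adj (R.erase w) (scanUpdate adj w S)) := by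
          rw [← mul_sum, sum_add_distrib, sum_cost_scanUpdate hsymm hirr]
      _ ≤ n.factorial * (R.card * ∑ u ∈ R, (1 + (S u).2) + potential adj R S +
            (R.card - 1) * potential adj R S) := by
          gcongr
          exact sum_potential_scanUpdate_le hsymm hirr R S
      _ = (n + 1).factorial * (∑ u ∈ R, (1 + (S u).2) + potential adj R S) := by
          rw [hR, Nat.factorial_succ, Nat.add_sub_cancel]; ring

end RandomGreedy

section Oracle

variable {V : Type*} [Fintype V] [DecidableEq V]

/-- Two distinct edges sharing an endpoint. -/
def EdgesMeet (e f : Sym2 V) : Prop := f ≠ e ∧ ∃ v, v ∈ e ∧ v ∈ f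

omit [Fintype V] [DecidableEq V] in
lemma EdgesMeet.symm {e f : Sym2 V} (h : EdgesMeet e f) : EdgesMeet f e :=
  ⟨h.1.symm, h.2.imp fun _ hv => hv.symm⟩

/-- The neighbours of `e` of smaller priority, in increasing order of priority. -/
noncomputable def lowerNeighbors (π : Sym2 V → ℕ) (L : Finset (Sym2 V)) (e : Sym2 V) :
    List (Sym2 V) :=
  (L.filter fun f => f ≠ e ∧ (∃ v, v ∈ e ∧ v ∈ f) ∧ π f < π e).toList.mergeSort
    (fun a b => decide (π a ≤ π b))

lemma mem_lowerNeighbors {π : Sym2 V → ℕ} {L : Finset (Sym2 V)} {e f : Sym2 V} :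
    f ∈ lowerNeighbors π L e ↔ f ∈ L ∧ EdgesMeet e f ∧ π f < π e := by
  simp [lowerNeighbors, EdgesMeet, and_assoc]

/-- The answer and the number of calls of the edge oracle on the whole graph. -/
noncomputable def oracleOutcome (π : Sym2 V → ℕ) (L : Finset (Sym2 V)) (e : Sym2 V) : Bool × ℕ :=
  ((edgeOracle π L (fun _ => true) e).1, (edgeOracle π L (fun _ => true) e).2.2)

lemma eoQ_succ (π : Sym2 V → ℕ) (L : Finset (Sym2 V)) (fuel : ℕ) (e : Sym2 V) :
    eoQ π L (fun _ => true) (fuel + 1) e =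
      let r := (lowerNeighbors π L e).foldl (fun (s : Bool × Finset V × ℕ) f =>
          if s.1 then s
          else
            let t := eoQ π L (fun _ => true) fuel f
            (t.1, s.2.1 ∪ t.2.1, s.2.2 + t.2.2)) (false, ∅, 0)
      (!r.1, ends e ∪ r.2.1, (if e ∈ L then 1 else 0) + r.2.2) := by
  rw [eoQ, if_pos (fun _ _ => rfl)]
  rfl

lemma eoQ_eq_edgeOracle (π : Sym2 V → ℕ) (L : Finset (Sym2 V)) {fuel : ℕ} {e : Sym2 V}
    (h : π e < fuel) : eoQ π L (fun _ => true) fuel e = edgeOracle π L (fun _ => true) e := by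
  induction fuel using Nat.strong_induction_on generalizing e with
  | _ fuel ih =>
    obtain ⟨k, rfl⟩ : ∃ k, fuel = k + 1 := ⟨fuel - 1, by omega⟩
    rcases (Nat.lt_succ_iff.1 h).eq_or_lt with rfl | hk
    · rfl
    have hfold : ∀ (s : Bool × Finset V × ℕ) (f : Sym2 V), f ∈ lowerNeighbors π L e →
        (if s.1 then s else
          let t := eoQ π L (fun _ => true) k f
          (t.1, s.2.1 ∪ t.2.1, s.2.2 + t.2.2)) =
        (if s.1 then s else
          let t := eoQ π L (fun _ => true) (π e) f
          (t.1, s.2.1 ∪ t.2.1, s.2.2 + t.2.2)) := by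
      intro s f hf
      have hlt := (mem_lowerNeighbors.1 hf).2.2
      rw [ih k (Nat.lt_succ_self k) (hlt.trans hk), ih (π e) h hlt]
    rw [edgeOracle, eoQ_succ, eoQ_succ, List.foldl_ext _ _ _ hfold]

lemma oracleOutcome_eq (π : Sym2 V → ℕ) {L : Finset (Sym2 V)} {e : Sym2 V} (he : e ∈ L) :
    oracleOutcome π L e = scanResult ((lowerNeighbors π L e).foldl
      (fun s f => scanStep s (oracleOutcome π L f)) (false, 0)) := by
  have hfold : ∀ (l : List (Sym2 V)), (∀ f ∈ l, π f < π e) → ∀ s : Bool × Finset V × ℕ,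
      l.foldl (fun s f => scanStep s (oracleOutcome π L f)) (s.1, s.2.2) =
        let r := l.foldl (fun (s : Bool × Finset V × ℕ) f =>
          if s.1 then s
          else
            let t := eoQ π L (fun _ => true) (π e) f
            (t.1, s.2.1 ∪ t.2.1, s.2.2 + t.2.2)) s
        (r.1, r.2.2) := by
    intro l
    induction l with
    | nil => intros; rfl
    | cons f l ih =>
      intro hl s
      simp only [List.foldl_cons]
      rw [← ih (fun g hg => hl g (by simp [hg])), eoQ_eq_edgeOracle π L (hl f (by simp))]
      congr 1
      cases hs : s.1 <;> simp [scanStep, oracleOutcome, hs]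
  rw [hfold _ (fun f hf => (mem_lowerNeighbors.1 hf).2.2) (false, ∅, 0)]
  rw [oracleOutcome, edgeOracle, eoQ_succ, if_pos he]
  rfl

lemma lowerNeighbors_eq_filter {π : Sym2 V → ℕ} {L : Finset (Sym2 V)} {l pre suf : List (Sym2 V)}
    {e : Sym2 V} (hl : l = pre ++ e :: suf) (hsort : l.Pairwise fun a b => π a < π b)
    (hmem : ∀ f, f ∈ l ↔ f ∈ L) :
    lowerNeighbors π L e = pre.filter fun f => decide (EdgesMeet e f) := by
  subst hl
  obtain ⟨hpre, hsuf, hcross⟩ := List.pairwise_append.1 hsort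
  have hinj : ∀ a ∈ pre ++ e :: suf, ∀ b ∈ pre ++ e :: suf, π a = π b → a = b := by
    have hnd : ((pre ++ e :: suf).map π).Nodup :=
      (List.pairwise_map.2 hsort).imp fun h => h.ne
    exact fun a ha b hb h => List.inj_on_of_nodup_map hnd ha hb h
  have hmem' : ∀ f, f ∈ lowerNeighbors π L e ↔ f ∈ pre.filter fun f => decide (EdgesMeet e f) := by
    intro f
    rw [mem_lowerNeighbors, ← hmem f, List.mem_filter, decide_eq_true_iff]
    constructor
    · rintro ⟨hf, hm, hlt⟩
      refine ⟨?_, hm⟩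
      rcases List.mem_append.1 hf with hf | hf
      · exact hf
      rcases List.mem_cons.1 hf with rfl | hf
      · exact absurd rfl hm.1
      · exact absurd ((List.pairwise_cons.1 hsuf).1 f hf) hlt.asymm
    · rintro ⟨hf, hm⟩
      exact ⟨List.mem_append_left _ hf, hm, hcross f hf e (by simp)⟩
  have hnd : (lowerNeighbors π L e).Nodup :=
    (List.mergeSort_perm _ _).nodup_iff.2 (Finset.nodup_toList _)
  have hnd' : (pre.filter fun f => decide (EdgesMeet e f)).Nodup :=
    List.Nodup.filter _ (hpre.imp fun h => by rintro rfl; exact h.false)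
  refine List.Perm.eq_of_pairwise (le := fun a b => π a ≤ π b) ?_ ?_ ?_
    ((List.perm_ext_iff_of_nodup hnd hnd').2 hmem')
  · intro a b ha hb h1 h2
    exact hinj a ((hmem a).2 (mem_lowerNeighbors.1 ha).1) b
      (List.mem_append_left _ (List.mem_filter.1 hb).1) (le_antisymm h1 h2)
  · have := List.pairwise_mergeSort (le := fun a b : Sym2 V => decide (π a ≤ π b))
      (fun a b c hab hbc => by simp only [decide_eq_true_iff] at *; omega)
      (fun a b => by simp only [Bool.or_eq_true, decide_eq_true_iff]; omega)
      (L.filter fun f => f ≠ e ∧ (∃ v, v ∈ e ∧ v ∈ f) ∧ π f < π e).toList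
    exact this.imp fun h => by simpa using h
  · exact (hpre.filter _).imp fun h => h.le

lemma sum_oracleOutcome {π : Sym2 V → ℕ} {L : Finset (Sym2 V)} {l : List (Sym2 V)}
    (hsort : l.Pairwise fun a b => π a < π b) (hmem : ∀ f, f ∈ l ↔ f ∈ L) :
    ∑ e ∈ L, (oracleOutcome π L e).2 = totalCalls EdgesMeet l fun _ => (false, 0) := by
  have hnd : l.Nodup := hsort.imp fun h => by rintro rfl; exact h.false
  rw [totalCalls_eq_sum (o := oracleOutcome π L), ← List.sum_toFinset _ hnd]
  · exact sum_congr (by ext f; simp [hmem]) fun _ _ => rfl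
  · intro pre w suf hl
    rw [oracleOutcome_eq π ((hmem w).1 (by simp [hl])), lowerNeighbors_eq_filter hl hsort hmem]

/-- The list of the edges in the order of the priorities induced by a permutation. -/
noncomputable def edgeOrder (E : Finset (Sym2 V)) (τ : Equiv.Perm (Fin E.card)) : List (Sym2 V) :=
  List.ofFn fun i => (E.equivFin.symm (τ.symm i) : Sym2 V)

omit [Fintype V] [DecidableEq V] in
lemma length_edgeOrder (E : Finset (Sym2 V)) (τ : Equiv.Perm (Fin E.card)) :
    (edgeOrder E τ).length = E.card := by simp [edgeOrder]

omit [Fintype V] [DecidableEq V] in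
lemma mem_edgeOrder {E : Finset (Sym2 V)} {τ : Equiv.Perm (Fin E.card)} {f : Sym2 V} :
    f ∈ edgeOrder E τ ↔ f ∈ E := by
  rw [edgeOrder, List.mem_ofFn]
  constructor
  · rintro ⟨i, rfl⟩
    exact (E.equivFin.symm (τ.symm i)).2
  · exact fun hf => ⟨τ (E.equivFin ⟨f, hf⟩), by simp⟩

omit [Fintype V] [DecidableEq V] in
lemma edgeOrder_injective (E : Finset (Sym2 V)) : Function.Injective (edgeOrder E) := by
  intro τ τ' h
  have h := List.ofFn_injective h
  refine Equiv.symm_bijective.injective (Equiv.ext fun i => ?_)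
  exact E.equivFin.symm.injective (Subtype.ext (congrFun h i))

omit [Fintype V] in
lemma pairwise_edgeOrder (E : Finset (Sym2 V)) (τ : Equiv.Perm (Fin E.card)) :
    (edgeOrder E τ).Pairwise fun a b => prioOf E τ a < prioOf E τ b := by
  rw [edgeOrder, List.pairwise_ofFn]
  intro i j hij
  simpa [prioOf] using hij

lemma potential_edgesMeet (E : Finset (Sym2 V)) :
    potential EdgesMeet E (fun _ => (false, 0)) =
      ((E ×ˢ E).filter fun q => q.1 ≠ q.2 ∧ ∃ v, v ∈ q.1 ∧ v ∈ q.2).card := by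
  rw [potential, ← sum_product', card_filter]
  refine sum_congr rfl fun q _ => ?_
  simp [EdgesMeet, ne_comm (a := q.1)]

end Oracle

/-- **Expected query complexity of the greedy matching oracle**
(Yoshida–Yamamoto–Ito; Proposition A.3).  Let `G` be a graph with `m` edges and `r` pairs
of intersecting edges (pairs of distinct edges sharing an endpoint).  If the ordering `π`
of the edges is drawn uniformly at random (below: averaging over all permutations `τ` of
`Fin m`, transported to `E` by its canonical enumeration), then
`E_π[ ∑_{e ∈ E} A(e) ] ≤ m + 2r`, where `A(e)` is the total number of (recursive) calls to
`EdgeOracle_π` generated by running `EdgeOracle_π(e)`. -/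
theorem expected_query_complexity_greedy_matching
    {V : Type*} [Fintype V] [DecidableEq V]
    (E : Finset (Sym2 V)) (hE : ∀ e ∈ E, ¬ e.IsDiag)
    (r : ℕ)
    (hr : 2 * r = ((E ×ˢ E).filter fun q => q.1 ≠ q.2 ∧ ∃ v, v ∈ q.1 ∧ v ∈ q.2).card) :
    (∑ τ : Equiv.Perm (Fin E.card), ∑ e ∈ E,
        ((edgeOracle (prioOf E τ) E (fun _ => true) e).2.2 : ℝ)) /
      (Fintype.card (Equiv.Perm (Fin E.card)) : ℝ) ≤ E.card + 2 * r := by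
  have hle : ∑ τ : Equiv.Perm (Fin E.card), ∑ e ∈ E,
      (edgeOracle (prioOf E τ) E (fun _ => true) e).2.2 ≤
      E.card.factorial * (E.card + 2 * r) := by
    calc ∑ τ : Equiv.Perm (Fin E.card), ∑ e ∈ E,
          (edgeOracle (prioOf E τ) E (fun _ => true) e).2.2
        = ∑ τ : Equiv.Perm (Fin E.card),
            totalCalls EdgesMeet (edgeOrder E τ) fun _ => (false, 0) :=
          sum_congr rfl fun τ _ =>
            sum_oracleOutcome (pairwise_edgeOrder E τ) fun _ => mem_edgeOrder
      _ = ∑ l ∈ Finset.univ.image (edgeOrder E), totalCalls EdgesMeet l fun _ => (false, 0) :=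
          by rw [sum_image (edgeOrder_injective E).injOn]
      _ ≤ ∑ l ∈ orderings E.card E, totalCalls EdgesMeet l fun _ => (false, 0) := by
          refine sum_le_sum_of_subset fun l hl => ?_
          obtain ⟨τ, -, rfl⟩ := mem_image.1 hl
          have hnd : (edgeOrder E τ).Nodup :=
            (pairwise_edgeOrder E τ).imp fun h => by rintro rfl; exact h.false
          simpa only [length_edgeOrder] using mem_orderings hnd fun _ => mem_edgeOrder.1
      _ ≤ E.card.factorial * (∑ u ∈ E, (1 + 0) + potential EdgesMeet E fun _ => (false, 0)) :=
          sum_totalCalls_le (fun _ _ => EdgesMeet.symm) (fun _ h => h.1 rfl) rfl _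
      _ = E.card.factorial * (E.card + 2 * r) := by
          rw [potential_edgesMeet, ← hr]; simp
  rw [Fintype.card_perm, Fintype.card_fin,
    div_le_iff₀ (by exact_mod_cast Nat.factorial_pos _), mul_comm]
  exact_mod_cast hle
end
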